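/- Let n > 3, s ≥ 1 and let Λ = (λ_1,…,λ_n), λ_j ∈ ℂ, be weakly hyperbolic. Let X = (w,z) ∈ Z_{(Λ,n,s)} with w_r ≠ 0 for every r, let T ∈ ℂ, μ ∈ ℝ, and suppose the vector v(T,μ) = −i(2 conj(T) conj(w_1) + μ w_1, …, 2 conj(T) conj(w_s) + μ w_s, (2 Re(T λ_1) + μ) z_1, …, (2 Re(T λ_n) + μ) z_n) lies in the tangent space T_X. Then there exists t ∈ ℝ such that T = t ∑_{r=1}^s conj(w_r)² and μ = −2t ∑_{r=1}^s |w_r|². -/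

import Mathlib

open scoped BigOperators

/-- `Λ` is weakly hyperbolic (`k = 2`). -/
def WeaklyHyperbolicC {n : ℕ} (Λ : Fin n → ℂ) : Prop :=
  ∀ J : Finset (Fin n), J.card ≤ 2 → (0 : ℂ) ∉ convexHull ℝ (Λ '' ↑J)

/-- The manifold `Z_{(Λ,n,s)} ⊆ ℂ^s × ℂ^n` cut out by
`F_s(w,z) = ∑ w_r² + ∑ λ_j |z_j|² = 0` and `ρ_s(w,z) = ∑ |w_r|² + ∑ |z_j|² = 1`. -/
def ZLS (s : ℕ) {n : ℕ} (Λ : Fin n → ℂ) : Set ((Fin s → ℂ) × (Fin n → ℂ)) :=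
  {X | (∑ r, X.1 r ^ 2) + (∑ j, Λ j * (Complex.normSq (X.2 j) : ℂ)) = 0 ∧
       (∑ r, Complex.normSq (X.1 r)) + (∑ j, Complex.normSq (X.2 j)) = 1}

/-- The tangent space of `Z_{(Λ,n,s)}` at `X = (w,z)`: all `v = (a,b) ∈ ℂ^s × ℂ^n` with
`∑ 2 w_r a_r + ∑ λ_j (conj(z_j) b_j + z_j conj(b_j)) = 0` and
`Re(∑ conj(w_r) a_r + ∑ conj(z_j) b_j) = 0`. -/
def TangentAt (s : ℕ) {n : ℕ} (Λ : Fin n → ℂ)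
    (X v : (Fin s → ℂ) × (Fin n → ℂ)) : Prop :=
  ((∑ r, 2 * X.1 r * v.1 r) +
      (∑ j, Λ j * ((starRingEnd ℂ) (X.2 j) * v.2 j + X.2 j * (starRingEnd ℂ) (v.2 j))) = 0) ∧
  ((∑ r, (starRingEnd ℂ) (X.1 r) * v.1 r) + (∑ j, (starRingEnd ℂ) (X.2 j) * v.2 j)).re = 0

/-- The `1`-form
`α_X(a,b) = i(∑ (w_r conj(a_r) − conj(w_r) a_r) + ∑ (z_j conj(b_j) − conj(z_j) b_j))`. -/
noncomputable def alphaForm {s n : ℕ} (X v : (Fin s → ℂ) × (Fin n → ℂ)) : ℂ :=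
  Complex.I *
    ((∑ r, (X.1 r * (starRingEnd ℂ) (v.1 r) - (starRingEnd ℂ) (X.1 r) * v.1 r)) +
     (∑ j, (X.2 j * (starRingEnd ℂ) (v.2 j) - (starRingEnd ℂ) (X.2 j) * v.2 j)))

/-- The constant `2`-form
`dα(u,v) = 2i(∑ (u_r conj(v_r) − v_r conj(u_r)) + ∑ (u_{s+j} conj(v_{s+j}) − v_{s+j} conj(u_{s+j})))`. -/
noncomputable def dAlpha {s n : ℕ} (u v : (Fin s → ℂ) × (Fin n → ℂ)) : ℂ :=
  2 * Complex.I *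
    ((∑ r, (u.1 r * (starRingEnd ℂ) (v.1 r) - v.1 r * (starRingEnd ℂ) (u.1 r))) +
     (∑ j, (u.2 j * (starRingEnd ℂ) (v.2 j) - v.2 j * (starRingEnd ℂ) (u.2 j))))

/-- The vector `v(T,μ) = −i(2 conj(T) conj(w_1) + μ w_1, …, 2 conj(T) conj(w_s) + μ w_s,
(2 Re(T λ_1) + μ) z_1, …, (2 Re(T λ_n) + μ) z_n)`. -/
noncomputable def vTmu {s n : ℕ} (Λ : Fin n → ℂ) (X : (Fin s → ℂ) × (Fin n → ℂ)) (T : ℂ) (μ : ℝ) :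
    (Fin s → ℂ) × (Fin n → ℂ) :=
  (fun r => -Complex.I * (2 * (starRingEnd ℂ) T * (starRingEnd ℂ) (X.1 r) + (μ : ℂ) * X.1 r),
   fun j => -Complex.I * (((2 * (T * Λ j).re + μ : ℝ) : ℂ) * X.2 j))

/-- If `X = (w,z) ∈ Z_{(Λ,n,s)}` has `w_r ≠ 0` for every `r` and the vector `v(T,μ)` is
tangent to `Z_{(Λ,n,s)}` at `X`, then `T = t ∑ conj(w_r)²` and `μ = −2t ∑ |w_r|²` for some
real number `t`. -/
theorem vTmu_tangent_constraint {n s : ℕ} (hn : 3 < n) (hs : 1 ≤ s)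
    (Λ : Fin n → ℂ) (hΛ : WeaklyHyperbolicC Λ)
    (X : (Fin s → ℂ) × (Fin n → ℂ)) (hX : X ∈ ZLS s Λ) (hw : ∀ r, X.1 r ≠ 0)
    (T : ℂ) (μ : ℝ) (hv : TangentAt s Λ X (vTmu Λ X T μ)) :
    ∃ t : ℝ, T = (t : ℂ) * (∑ r, ((starRingEnd ℂ) (X.1 r)) ^ 2) ∧
      μ = -2 * t * (∑ r, Complex.normSq (X.1 r)) := by
  have hA : 0 < ∑ r, Complex.normSq (X.1 r) :=
    Finset.sum_pos (fun r _ => Complex.normSq_pos.2 (hw r)) ⟨⟨0, hs⟩, Finset.mem_univ _⟩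
  set A := ∑ r, Complex.normSq (X.1 r) with hA_def
  have hAc : (A : ℂ) ≠ 0 := by exact_mod_cast hA.ne'
  have hz : ∀ j, Λ j * ((starRingEnd ℂ) (X.2 j) * (vTmu Λ X T μ).2 j +
      X.2 j * (starRingEnd ℂ) ((vTmu Λ X T μ).2 j)) = 0 := by
    intro j
    simp only [vTmu, map_mul, map_neg, Complex.conj_I, Complex.conj_ofReal]
    ring
  have hw_sum : ∑ r, 2 * X.1 r * (vTmu Λ X T μ).1 r =
      -2 * Complex.I * (2 * (starRingEnd ℂ) T * A + μ * ∑ r, X.1 r ^ 2) := by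
    rw [hA_def, Complex.ofReal_sum, Finset.mul_sum, Finset.mul_sum, ← Finset.sum_add_distrib,
      Finset.mul_sum]
    refine Finset.sum_congr rfl fun r _ => ?_
    simp only [vTmu, ← Complex.mul_conj]
    ring
  have hrel : 2 * (starRingEnd ℂ) T * A + μ * ∑ r, X.1 r ^ 2 = 0 := by
    have h := hv.1
    rw [Finset.sum_eq_zero fun j _ => hz j, add_zero, hw_sum] at h
    simpa using h
  have hrel_conj : 2 * T * A + μ * ∑ r, ((starRingEnd ℂ) (X.1 r)) ^ 2 = 0 := by
    simpa [Complex.conj_ofNat] using congrArg (starRingEnd ℂ) hrel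
  refine ⟨-μ / (2 * A), ?_, ?_⟩
  · push_cast
    field_simp
    linear_combination hrel_conj
  · field_simp
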